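/- arXiv:2111.13625 — 6 statements merged into one kernel-verified Lean document; each statement's English description precedes it below -/
import Mathlib

section
/- Let M be a partially ordered monoid, (X, d, Z(M)) an equipped DM-distance space, and set 𝓜 = M₊ \ {θ_M}. Suppose φ : 𝓜 → 𝓜 and ζ : 𝓜 × 𝓜 → 𝓜 satisfy: (i) for every sequence {α_n} in 𝓜, if {φ(α_n)} ∈ Z(M) then {α_n} ∈ Z(M); (ii) for all sequences {α_n}, {β_n} in 𝓜, if {α_n}, {β_n} ∈ Z(M) then {ζ(α_n, β_n)} ∈ Z(M); and (iii) φ(d(x,y)) ≤ ζ(d(x,z), d(z,y)) for all x, y, z ∈ X such that d(x,y), d(x,z), d(y,z) ∈ 𝓜. Then (X, d, Z(M)) is Hausdorff: every convergent sequence has a unique limit. -/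
/-- Compatibility of addition with the partial order in a partially ordered monoid:
`x₁ ≤ y₁` and `x₂ ≤ y₂` imply `x₁ + x₂ ≤ y₁ + y₂`. -/
def AddOrderCompat (M : Type*) [AddMonoid M] [PartialOrder M] : Prop :=
  ∀ a b c e : M, a ≤ b → c ≤ e → a + c ≤ b + e

/-- `M₊ := {x : θ ≤ x}` is not reduced to `{θ}`. -/
def PosNontrivial (M : Type*) [AddMonoid M] [PartialOrder M] : Prop :=
  ∃ x : M, 0 ≤ x ∧ x ≠ 0

/-- A family of null sequences in a partially ordered monoid `M`. -/
structure IsNullFamily {M : Type*} [AddMonoid M] [PartialOrder M]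
    (Z : Set (ℕ → M)) : Prop where
  nonneg : ∀ s ∈ Z, ∀ n, (0 : M) ≤ s n
  zero_mem : (fun _ : ℕ => (0 : M)) ∈ Z
  const_eq_zero : ∀ x : M, 0 ≤ x → (fun _ : ℕ => x) ∈ Z → x = 0
  add_mem : ∀ s t : ℕ → M, s ∈ Z → t ∈ Z → (fun n => s n + t n) ∈ Z
  squeeze : ∀ s t : ℕ → M, s ∈ Z → (∀ n, (0 : M) ≤ t n) → (∀ n, t n ≤ s n) → t ∈ Z
  subseq : ∀ s ∈ Z, ∀ φ : ℕ → ℕ, StrictMono φ → (fun n => s (φ n)) ∈ Z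

/-- An `M`-valued dislocated distance on a set `X`. -/
structure IsDMDistance {M : Type*} [AddMonoid M] [PartialOrder M] {X : Type*}
    (d : X → X → M) : Prop where
  nonneg : ∀ x y, (0 : M) ≤ d x y
  symm : ∀ x y, d x y = d y x
  eq_of_eq_zero : ∀ x y, d x y = 0 → x = y

/-- Convergence of a sequence in an equipped DM-distance space. -/
def ConvTo {M : Type*} [AddMonoid M] [PartialOrder M] {X : Type*}
    (Z : Set (ℕ → M)) (d : X → X → M) (x : ℕ → X) (a : X) : Prop :=
  (fun n => d (x n) a) ∈ Z

/-- Hausdorffness: every convergent sequence has a unique limit. -/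
def IsHausdorffSpace {M : Type*} [AddMonoid M] [PartialOrder M] {X : Type*}
    (Z : Set (ℕ → M)) (d : X → X → M) : Prop :=
  ∀ (x : ℕ → X) (a b : X), ConvTo Z d x a → ConvTo Z d x b → a = b

/-- `listSum u a n = u a + u (a+1) + ⋯ + u (a+n-1)` (ordered sum of `n` terms starting
at index `a`; the monoid need not be commutative). -/
def listSum {M : Type*} [AddMonoid M] (u : ℕ → M) (a n : ℕ) : M :=
  ((List.range n).map fun i => u (a + i)).sum

/-- `∑ x_k` is a Cauchy series: for all increasing `{n_k}`, `{m_k}` with `m_k ≥ n_k`,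
the block sums `∑_{s=n_k}^{m_k} x_s` form a null sequence. -/
def IsCauchySeriesZ {M : Type*} [AddMonoid M] [PartialOrder M]
    (Z : Set (ℕ → M)) (u : ℕ → M) : Prop :=
  ∀ nk mk : ℕ → ℕ, StrictMono nk → StrictMono mk → (∀ k, nk k ≤ mk k) →
    (fun k => listSum u (nk k) (mk k + 1 - nk k)) ∈ Z

/-- Cauchy sequence in an equipped DM-distance space. -/
def IsCauchySeqZ {M : Type*} [AddMonoid M] [PartialOrder M] {X : Type*}
    (Z : Set (ℕ → M)) (d : X → X → M) (x : ℕ → X) : Prop :=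
  ∀ nk mk : ℕ → ℕ, StrictMono nk → StrictMono mk → (∀ k, nk k < mk k) →
    (fun k => d (x (nk k)) (x (mk k))) ∈ Z

/-- H-completeness: every Cauchy sequence converges. -/
def HComplete {M : Type*} [AddMonoid M] [PartialOrder M] {X : Type*}
    (Z : Set (ℕ → M)) (d : X → X → M) : Prop :=
  ∀ x : ℕ → X, IsCauchySeqZ Z d x → ∃ a, ConvTo Z d x a

/-- W-completeness: every sequence `{x_n}` with `∑ d(x_n, x_{n+1})` a Cauchy series
converges. -/
def WComplete {M : Type*} [AddMonoid M] [PartialOrder M] {X : Type*}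
    (Z : Set (ℕ → M)) (d : X → X → M) : Prop :=
  ∀ x : ℕ → X, IsCauchySeriesZ Z (fun n => d (x n) (x (n + 1))) → ∃ a, ConvTo Z d x a

/-- The weak Fréchet–Wilson property. -/
def WeakFW {M : Type*} [AddMonoid M] [PartialOrder M] {X : Type*}
    (Z : Set (ℕ → M)) (d : X → X → M) : Prop :=
  ∀ (x y : ℕ → X) (z : X), (fun n => d (x n) (y n)) ∈ Z → (fun n => d (y n) z) ∈ Z →
    (fun n => d (x n) z) ∈ Z

/-- The Fréchet–Wilson property. -/
def FWProp {M : Type*} [AddMonoid M] [PartialOrder M] {X : Type*}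
    (Z : Set (ℕ → M)) (d : X → X → M) : Prop :=
  ∀ x y z : ℕ → X, (fun n => d (x n) (z n)) ∈ Z → (fun n => d (z n) (y n)) ∈ Z →
    (fun n => d (x n) (y n)) ∈ Z

/-- The strong Fréchet–Wilson property: if the block sums
`∑_{s=n_k}^{m_k-1} d(x_s, x_{s+1})` form a null sequence then so does
`{d(x_{n_k}, x_{m_k})}`. -/
def StrongFW {M : Type*} [AddMonoid M] [PartialOrder M] {X : Type*}
    (Z : Set (ℕ → M)) (d : X → X → M) : Prop :=
  ∀ (x : ℕ → X) (nk mk : ℕ → ℕ), StrictMono nk → StrictMono mk →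
    (∀ k, nk k < mk k) →
    (fun k => listSum (fun s => d (x s) (x (s + 1))) (nk k) (mk k - nk k)) ∈ Z →
    (fun k => d (x (nk k)) (x (mk k))) ∈ Z

/-- an `EDM_{(φ,ζ)}`-metric space (with `𝓜 = M₊ \ {θ}`) is Hausdorff. -/
theorem hausdorff_of_phi_zeta_metric {M : Type*} [AddMonoid M] [PartialOrder M]
    {X : Type*}
    (hcompat : AddOrderCompat M) (hpos : PosNontrivial M)
    (Z : Set (ℕ → M)) (hZ : IsNullFamily Z)
    (d : X → X → M) (hd : IsDMDistance d)
    (φ : M → M) (ζ : M → M → M)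
    (hφmap : ∀ m : M, 0 ≤ m → m ≠ 0 → 0 ≤ φ m ∧ φ m ≠ 0)
    (hζmap : ∀ a b : M, 0 ≤ a → a ≠ 0 → 0 ≤ b → b ≠ 0 → 0 ≤ ζ a b ∧ ζ a b ≠ 0)
    (hφnull : ∀ α : ℕ → M, (∀ n, 0 ≤ α n ∧ α n ≠ 0) →
      (fun n => φ (α n)) ∈ Z → α ∈ Z)
    (hζnull : ∀ α β : ℕ → M, (∀ n, 0 ≤ α n ∧ α n ≠ 0) → (∀ n, 0 ≤ β n ∧ β n ≠ 0) →
      α ∈ Z → β ∈ Z → (fun n => ζ (α n) (β n)) ∈ Z)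
    (htri : ∀ x y z : X,
      (0 ≤ d x y ∧ d x y ≠ 0) → (0 ≤ d x z ∧ d x z ≠ 0) → (0 ≤ d y z ∧ d y z ≠ 0) →
      φ (d x y) ≤ ζ (d x z) (d z y)) :
    IsHausdorffSpace Z d := by
  intro x a b ha hb
  unfold ConvTo at ha hb
  by_contra hab
  have hne : d a b ≠ 0 := fun h => hab (hd.eq_of_eq_zero a b h)
  by_cases h1 : ∃ᶠ n in Filter.atTop, d (x n) a = 0
  · obtain ⟨k, hk, hk0⟩ := Filter.extraction_of_frequently_atTop h1
    have h := hZ.subseq _ hb k hk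
    have he : (fun n => d (x (k n)) b) = fun _ => d a b := by
      funext n
      rw [hd.eq_of_eq_zero _ _ (hk0 n)]
    exact hne (hZ.const_eq_zero _ (hd.nonneg a b) (he ▸ h))
  by_cases h2 : ∃ᶠ n in Filter.atTop, d (x n) b = 0
  · obtain ⟨k, hk, hk0⟩ := Filter.extraction_of_frequently_atTop h2
    have h := hZ.subseq _ ha k hk
    have he : (fun n => d (x (k n)) a) = fun _ => d a b := by
      funext n
      rw [hd.eq_of_eq_zero _ _ (hk0 n), hd.symm]
    exact hne (hZ.const_eq_zero _ (hd.nonneg a b) (he ▸ h))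
  rw [Filter.not_frequently] at h1 h2
  obtain ⟨k, hk, hk0⟩ := Filter.extraction_of_frequently_atTop (h1.and h2).frequently
  have hA := hZ.subseq _ ha k hk
  have hB := hZ.subseq _ hb k hk
  have hz := hζnull (fun n => d (x (k n)) a) (fun n => d (x (k n)) b)
    (fun n => ⟨hd.nonneg _ _, (hk0 n).1⟩) (fun n => ⟨hd.nonneg _ _, (hk0 n).2⟩) hA hB
  have hp := hφmap (d a b) (hd.nonneg _ _) hne
  have hc : (fun _ : ℕ => φ (d a b)) ∈ Z := by
    refine hZ.squeeze _ _ hz (fun _ => hp.1) (fun n => ?_)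
    have h := htri a b (x (k n)) ⟨hd.nonneg _ _, hne⟩
      ⟨hd.nonneg _ _, by rw [hd.symm]; exact (hk0 n).1⟩
      ⟨hd.nonneg _ _, by rw [hd.symm]; exact (hk0 n).2⟩
    rwa [hd.symm a (x (k n))] at h
  exact hp.2 (hZ.const_eq_zero _ hp.1 hc)
end

section
/- In every equipped DM-distance space (X, d, Z(M)): the strong Fréchet–Wilson property implies the Fréchet–Wilson property; the Fréchet–Wilson property implies the weak Fréchet–Wilson property; and the weak Fréchet–Wilson property implies that the space is Hausdorff. -/
/-- strong Fréchet–Wilson ⇒ Fréchet–Wilson ⇒ weak Fréchet–Wilson ⇒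
Hausdorff. -/
theorem frechetWilson_implications {M : Type*} [AddMonoid M] [PartialOrder M]
    {X : Type*}
    (hcompat : AddOrderCompat M) (hpos : PosNontrivial M)
    (Z : Set (ℕ → M)) (hZ : IsNullFamily Z)
    (d : X → X → M) (hd : IsDMDistance d) :
    (StrongFW Z d → FWProp Z d) ∧ (FWProp Z d → WeakFW Z d) ∧
      (WeakFW Z d → IsHausdorffSpace Z d) := by
  refine ⟨?_, ?_, ?_⟩
  · intro h x y z h1 h2
    let w : ℕ → X := fun n =>
      if n % 3 = 0 then x (n / 3) else if n % 3 = 1 then z (n / 3) else y (n / 3)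
    have w0 : ∀ k, w (3 * k) = x k := fun k => by
      have e1 : 3 * k % 3 = 0 := by omega
      have e2 : 3 * k / 3 = k := by omega
      simp only [w, e1, e2, if_true]
    have w1 : ∀ k, w (3 * k + 1) = z k := fun k => by
      have e1 : (3 * k + 1) % 3 = 1 := by omega
      have e2 : (3 * k + 1) / 3 = k := by omega
      simp [w, e1, e2]
    have w2 : ∀ k, w (3 * k + 2) = y k := fun k => by
      have e1 : (3 * k + 2) % 3 = 2 := by omega
      have e2 : (3 * k + 2) / 3 = k := by omega
      simp [w, e1, e2]
    have key := h w (fun k => 3 * k) (fun k => 3 * k + 2)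
      (fun a b hab => by simp only; omega) (fun a b hab => by simp only; omega)
      (fun k => by omega) (by
        convert hZ.add_mem _ _ h1 h2 using 2 with k
        have e : 3 * k + 2 - 3 * k = 2 := by omega
        simp only [e]
        simp [listSum, List.range_succ, w0, w1, w2, add_assoc])
    simpa only [w0, w2] using key
  · intro h x y z h1 h2
    exact h x (fun _ => z) y h1 h2
  · intro h x a b ha hb
    have ha' : (fun n => d a (x n)) ∈ Z := by
      have e : (fun n => d a (x n)) = fun n => d (x n) a := funext fun n => hd.symm _ _
      rw [e]
      exact ha
    exact hd.eq_of_eq_zero _ _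
      (hZ.const_eq_zero _ (hd.nonneg a b) (h (fun _ => a) x b ha' hb))
end

section
/- Let (X, d, Z(M)) be an equipped DM-distance space such that for every y ∈ X the function d(·, y) is semi-continuous from below, i.e. for every x ∈ X and every sequence {x_n} converging to x there exist a subsequence {x_{n_k}} and a sequence {α_k} ∈ Z(M) with d(x, y) ≤ d(x_{n_k}, y) + α_k for all k. Then (X, d, Z(M)) is Hausdorff. -/
/-- if for every `y` the function `d(·, y)` is semi-continuous from
below, then the space is Hausdorff. -/
theorem hausdorff_of_semicontinuous {M : Type*} [AddMonoid M] [PartialOrder M]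
    {X : Type*}
    (hcompat : AddOrderCompat M) (hpos : PosNontrivial M)
    (Z : Set (ℕ → M)) (hZ : IsNullFamily Z)
    (d : X → X → M) (hd : IsDMDistance d)
    (hsc : ∀ (y x : X) (xn : ℕ → X), ConvTo Z d xn x →
      ∃ φ : ℕ → ℕ, StrictMono φ ∧ ∃ α ∈ Z, ∀ k, d x y ≤ d (xn (φ k)) y + α k) :
    IsHausdorffSpace Z d := by
  intro x a b ha hb
  obtain ⟨φ, hφ, α, hα, h⟩ := hsc b a x ha
  exact hd.eq_of_eq_zero a b (hZ.const_eq_zero _ (hd.nonneg a b)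
    (hZ.squeeze _ _ (hZ.add_mem _ _ (hZ.subseq _ hb φ hφ) hα) (fun _ => hd.nonneg a b) h))
end

section
/- Let (X, d, Z_E(M)) be an H-complete equipped DM-distance space. Let ζ : M₊ × M₊ → M₊ be non-decreasing in each coordinate, satisfy ζ(ε, δ) ≥ ε and ζ(ε, δ) ≥ δ for all ε, δ ∈ E, and map pairs of null sequences to null sequences (if {α_n}, {β_n} ∈ Z_E(M) then {ζ(α_n, β_n)} ∈ Z_E(M)); suppose the triangle-type inequality d(x, y) ≤ ζ(d(x, z), d(z, y)) holds for all x, y, z ∈ X. Let f : X → X satisfy: for every ε ∈ E there exists δ ∈ E such that for all x, y ∈ X, d(x, y) ≤ ζ(δ, ε) implies d(f(x), f(y)) < ε. Assume there exists x ∈ X such that {d(fⁿ(x), f^{n+1}(x))} ∈ Z_E(M). Then f has a fixed point. -/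
/-- The defining properties of the set `E ⊆ M₊ \ {θ}` generating the family `Z_E(M)`. -/
structure IsEFamily {M : Type*} [AddMonoid M] [PartialOrder M] (E : Set M) : Prop where
  nonempty : E.Nonempty
  pos : ∀ ε ∈ E, (0 : M) ≤ ε ∧ ε ≠ 0
  le_all_eq_zero : ∀ x : M, 0 ≤ x → (∀ ε ∈ E, x ≤ ε) → x = 0
  half : ∀ ε ∈ E, ∃ δ ∈ E, δ + δ ≤ ε

/-- The family `Z_E(M)` of null sequences determined by `E`. -/
def ZE {M : Type*} [AddMonoid M] [PartialOrder M] (E : Set M) : Set (ℕ → M) :=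
  {s | (∀ n, (0 : M) ≤ s n) ∧ ∀ ε ∈ E, ∃ N, ∀ n ≥ N, s n < ε}

/-- Meir–Keeler–Taylor type theorem under the orbit condition
`{d(fⁿ(x), f^{n+1}(x))} ∈ Z_E(M)`. -/
theorem meirKeeler_fixedPoint_of_orbit {M : Type*} [AddMonoid M] [PartialOrder M]
    {X : Type*}
    (hcompat : AddOrderCompat M) (hpos : PosNontrivial M)
    (E : Set M) (hE : IsEFamily E)
    (d : X → X → M) (hd : IsDMDistance d)
    (hcomplete : HComplete (ZE E) d)
    (ζ : M → M → M)
    (hζpos : ∀ a b : M, 0 ≤ a → 0 ≤ b → 0 ≤ ζ a b)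
    (hζmono₁ : ∀ a a' b : M, 0 ≤ a → 0 ≤ a' → 0 ≤ b → a ≤ a' → ζ a b ≤ ζ a' b)
    (hζmono₂ : ∀ a b b' : M, 0 ≤ a → 0 ≤ b → 0 ≤ b' → b ≤ b' → ζ a b ≤ ζ a b')
    (hζge : ∀ ε ∈ E, ∀ δ ∈ E, ε ≤ ζ ε δ ∧ δ ≤ ζ ε δ)
    (hζnull : ∀ α β : ℕ → M, α ∈ ZE E → β ∈ ZE E → (fun n => ζ (α n) (β n)) ∈ ZE E)
    (htri : ∀ x y z : X, d x y ≤ ζ (d x z) (d z y))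
    (f : X → X)
    (hf : ∀ ε ∈ E, ∃ δ ∈ E, ∀ x y : X, d x y ≤ ζ δ ε → d (f x) (f y) < ε)
    (horbit : ∃ x : X, (fun n => d (f^[n] x) (f^[n + 1] x)) ∈ ZE E) :
    ∃ x : X, f x = x := by
  obtain ⟨x, h0, hx⟩ := horbit
  have hpos' : ∀ ε ∈ E, (0 : M) ≤ ε := fun ε h => (hE.pos ε h).1
  have key : ∀ ε ∈ E, ∃ N, ∀ k, ∀ n ≥ N, d (f^[n] x) (f^[n + k + 1] x) < ε := by
    intro ε hε
    obtain ⟨δ, hδ, hfd⟩ := hf ε hε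
    obtain ⟨N1, h1⟩ := hx ε hε
    obtain ⟨N2, h2⟩ := hx δ hδ
    refine ⟨N1 + N2 + 1, fun k => ?_⟩
    induction k with
    | zero => intro n hn; exact h1 n (by omega)
    | succ k ih =>
      intro n hn
      obtain ⟨m, rfl⟩ : ∃ m, n = m + 1 := ⟨n - 1, by omega⟩
      have a1 := ih (m + 1) hn
      have a2 := h2 m (by omega)
      have a3 : d (f^[m] x) (f^[m + 1 + k + 1] x) ≤ ζ δ ε := by
        refine (htri _ _ (f^[m + 1] x)).trans ?_
        exact (hζmono₁ _ δ _ (hd.nonneg _ _) (hpos' δ hδ) (hd.nonneg _ _) a2.le).trans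
          (hζmono₂ _ _ _ (hpos' δ hδ) (hd.nonneg _ _) (hpos' ε hε) a1.le)
      have a4 := hfd _ _ a3
      rw [← Function.iterate_succ_apply' f, ← Function.iterate_succ_apply' f] at a4
      exact a4
  obtain ⟨a, ha0, ha⟩ := hcomplete (fun n => f^[n] x) (by
    intro nk mk hn hm hlt
    refine ⟨fun n => hd.nonneg _ _, fun ε hε => ?_⟩
    obtain ⟨N, hN⟩ := key ε hε
    refine ⟨N, fun k hk => ?_⟩
    have b1 := hN (mk k - nk k - 1) (nk k) (hk.trans (hn.id_le k))
    have b2 : nk k + (mk k - nk k - 1) + 1 = mk k := by have := hlt k; omega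
    rw [b2] at b1
    exact b1)
  have c1 : (fun n => d a (f^[n + 1] x)) ∈ ZE E := by
    refine ⟨fun n => hd.nonneg _ _, fun ε hε => ?_⟩
    obtain ⟨N, hN⟩ := ha ε hε
    refine ⟨N, fun n hn => ?_⟩
    have := hN (n + 1) (by omega)
    simp only [hd.symm a]
    exact this
  have c2 : (fun n => d (f^[n + 1] x) (f a)) ∈ ZE E := by
    refine ⟨fun n => hd.nonneg _ _, fun ε hε => ?_⟩
    obtain ⟨δ, hδ, hfd⟩ := hf ε hε
    obtain ⟨N, hN⟩ := ha ε hε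
    refine ⟨N, fun n hn => ?_⟩
    have := hfd _ _ ((hN n hn).le.trans (hζge δ hδ ε hε).2)
    simp only [Function.iterate_succ_apply']
    exact this
  obtain ⟨_, hz⟩ := hζnull _ _ c1 c2
  refine ⟨a, (hd.eq_of_eq_zero a (f a) (hE.le_all_eq_zero _ (hd.nonneg _ _) ?_)).symm⟩
  intro ε hε
  obtain ⟨N, hN⟩ := hz ε hε
  exact (htri _ _ _).trans (hN N le_rfl).le
end

section
/- Let (X, d, Z(M)) be an equipped DM-distance space, f : X → X, and {λ_n}_{n∈ℕ} a sequence of non-decreasing operators λ_n : M₊ → M₊ such that for every α ∈ M₊ the sequence {(λ₁ ∘ λ₂ ∘ … ∘ λ_n)(α)}_{n∈ℕ} belongs to Z(M). Assume that for arbitrary x₀, y₀ ∈ X: (a) for each n ∈ ℕ and all x ∈ O_n(f, x₀), y ∈ O_n(f, y₀) there exist x' ∈ O_{n−1}(f, x₀) and y' ∈ O_{n−1}(f, y₀) with d(x, y) ≤ λ_n(d(x', y')); (b) the set {d(x, y) : x ∈ O(f, x₀), y ∈ O(f, y₀)} admits an upper bound in M. Then f has at most one fixed point. -/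
/-- `f` is weakly orbitally continuous: if an orbit `{fⁿ(x)}` converges to `a`,
then `a` is a fixed point of `f`. -/
def WeaklyOrbContinuous {M : Type*} [AddMonoid M] [PartialOrder M] {X : Type*}
    (Z : Set (ℕ → M)) (d : X → X → M) (f : X → X) : Prop :=
  ∀ x a : X, ConvTo Z d (fun n => f^[n] x) a → f a = a

/-- `iterComp lam n = λ₁ ∘ λ₂ ∘ ⋯ ∘ λ_n` where `λ_i = lam (i-1)` (0-indexed). -/
def iterComp {M : Type*} (lam : ℕ → M → M) : ℕ → M → M
  | 0, a => a
  | n + 1, a => iterComp lam n (lam n a)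

/-- uniqueness of the fixed point under the two-orbit contraction and
boundedness conditions. -/
theorem ciric_uniqueness {M : Type*} [AddMonoid M] [PartialOrder M] {X : Type*}
    (hcompat : AddOrderCompat M) (hpos : PosNontrivial M)
    (Z : Set (ℕ → M)) (hZ : IsNullFamily Z)
    (d : X → X → M) (hd : IsDMDistance d)
    (f : X → X)
    (lam : ℕ → M → M)
    (hlampos : ∀ (n : ℕ) (a : M), 0 ≤ a → 0 ≤ lam n a)
    (hlammono : ∀ (n : ℕ) (a b : M), 0 ≤ a → a ≤ b → lam n a ≤ lam n b)
    (hnull : ∀ α : M, 0 ≤ α → (fun n => iterComp lam (n + 1) α) ∈ Z)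
    (hcontr : ∀ x₀ y₀ : X, ∀ n i j : ℕ, n + 1 ≤ i → n + 1 ≤ j →
      ∃ i' j' : ℕ, n ≤ i' ∧ n ≤ j' ∧
        d (f^[i] x₀) (f^[j] y₀) ≤ lam n (d (f^[i'] x₀) (f^[j'] y₀)))
    (hbdd : ∀ x₀ y₀ : X, ∃ β : M, ∀ n m : ℕ, d (f^[n] x₀) (f^[m] y₀) ≤ β) :
    ∀ a b : X, f a = a → f b = b → a = b := by
  intro a b ha hb
  have ia : ∀ n, f^[n] a = a := fun n => Function.iterate_fixed ha n
  have ib : ∀ n, f^[n] b = b := fun n => Function.iterate_fixed hb n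
  have hr : ∀ n, d a b ≤ lam n (d a b) := by
    intro n
    obtain ⟨i', j', _, _, h⟩ := hcontr a b n (n + 1) (n + 1) le_rfl le_rfl
    simpa only [ia, ib] using h
  have hmono : ∀ n : ℕ, ∀ u v : M, 0 ≤ u → u ≤ v → iterComp lam n u ≤ iterComp lam n v := by
    intro n
    induction n with
    | zero => intro u v _ h; exact h
    | succ k ih =>
      intro u v hu h
      exact ih _ _ (hlampos k u hu) (hlammono k u v hu h)
  have h0 := hd.nonneg a b
  have hle : ∀ n : ℕ, d a b ≤ iterComp lam n (d a b) := by
    intro n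
    induction n with
    | zero => exact le_rfl
    | succ k ih => exact ih.trans (hmono k _ _ h0 (hr k))
  exact hd.eq_of_eq_zero a b (hZ.const_eq_zero _ h0
    (hZ.squeeze _ _ (hnull _ h0) (fun _ => h0) (fun n => hle (n + 1))))
end

section
/- Let T be a compact metric space, μ a finite Borel measure on T, and X a real Banach space. Let f ∈ C(T, X), let Q : T × T → ℝ be continuous and non-negative, and let g : T × T × X → X be continuous and satisfy ‖g(t, s, u) − g(t, s, v)‖ ≤ Q(t, s)·‖u − v‖ for all t, s ∈ T and u, v ∈ X. Define the iterated kernels Q₁ := Q and Q_n(t, s) := ∫_T Q_{n−1}(t, u)·Q₁(u, s) dμ(u) for n ≥ 2. If the series ∑_{n=1}^∞ ∫_T Q_n(t, s) dμ(s) converges uniformly in t ∈ T (i.e. converges in the space C(T, ℝ) with the sup-norm), then there exists a unique continuous function x ∈ C(T, X) satisfying the Fredholm integral equation x(t) = f(t) + ∫_T g(t, s, x(s)) dμ(s) for all t ∈ T. -/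
open MeasureTheory

/-- The iterated kernels: `iterKernel μ Q 0 = Q₁ = Q` and
`iterKernel μ Q n t s = Q_{n+1}(t,s) = ∫ Q_n(t,u) · Q(u,s) dμ(u)`. -/
noncomputable def iterKernel {T : Type*} [MeasurableSpace T] (μ : Measure T)
    (Q : T → T → ℝ) : ℕ → T → T → ℝ
  | 0 => Q
  | n + 1 => fun t s => ∫ u, iterKernel μ Q n t u * Q u s ∂μ

theorem fr_integrable {T : Type*} [MetricSpace T] [CompactSpace T]
    [MeasurableSpace T] [BorelSpace T] (μ : Measure T) [IsFiniteMeasure μ]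
    {E : Type*} [NormedAddCommGroup E] {h : T → E} (hh : Continuous h) : Integrable h μ :=
  hh.integrable_of_hasCompactSupport (HasCompactSupport.of_compactSpace h)

theorem fr_param {T Z : Type*} [MetricSpace T] [CompactSpace T]
    [MeasurableSpace T] [BorelSpace T] (μ : Measure T) [IsFiniteMeasure μ]
    [MetricSpace Z] [CompactSpace Z]
    {E : Type*} [NormedAddCommGroup E] [NormedSpace ℝ E]
    {h : Z → T → E} (hh : Continuous fun p : Z × T => h p.1 p.2) :
    Continuous fun z => ∫ s, h z s ∂μ := by
  have := continuous_parametric_integral_of_continuous (μ := μ) (f := h) hh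
    (isCompact_univ (X := T))
  simpa using this

theorem fr_kernel_cont {T : Type*} [MetricSpace T] [CompactSpace T]
    [MeasurableSpace T] [BorelSpace T] (μ : Measure T) [IsFiniteMeasure μ]
    (Q : T → T → ℝ) (hQ : Continuous fun p : T × T => Q p.1 p.2) (n : ℕ) :
    Continuous fun p : T × T => iterKernel μ Q n p.1 p.2 := by
  induction n with
  | zero => exact hQ
  | succ n ih =>
    refine fr_param μ (h := fun (p : T × T) u => iterKernel μ Q n p.1 u * Q u p.2) ?_
    exact (ih.comp (f := fun q : (T × T) × T => (q.1.1, q.2)) (by fun_prop)).mul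
      (hQ.comp (f := fun q : (T × T) × T => (q.2, q.1.2)) (by fun_prop))

theorem fr_kernel_nonneg {T : Type*} [MeasurableSpace T] (μ : Measure T)
    (Q : T → T → ℝ) (hQ : ∀ t s, 0 ≤ Q t s) (n : ℕ) (t s : T) : 0 ≤ iterKernel μ Q n t s := by
  induction n generalizing t s with
  | zero => exact hQ t s
  | succ n ih => exact integral_nonneg fun u => mul_nonneg (ih t u) (hQ u s)

theorem fr_iter {T : Type*} [MetricSpace T] [CompactSpace T]
    [MeasurableSpace T] [BorelSpace T] (μ : Measure T) [IsFiniteMeasure μ]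
    {X : Type*} [NormedAddCommGroup X]
    (Q : T → T → ℝ) (hQ : Continuous fun p : T × T => Q p.1 p.2) (hQ0 : ∀ t s, 0 ≤ Q t s)
    (F : C(T, X) → C(T, X))
    (hF : ∀ x y t, ‖F x t - F y t‖ ≤ ∫ s, Q t s * ‖x s - y s‖ ∂μ) (n : ℕ) :
    ∀ x y t, ‖F^[n+1] x t - F^[n+1] y t‖ ≤ ∫ s, iterKernel μ Q n t s * ‖x s - y s‖ ∂μ := by
  induction n with
  | zero => exact hF
  | succ n ih =>
    intro x y t
    have hK := fr_kernel_cont μ Q hQ n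
    have hKt : Continuous fun u => iterKernel μ Q n t u :=
      hK.comp (f := fun u => (t, u)) (by fun_prop)
    have hd : Continuous fun s => ‖x s - y s‖ := by fun_prop
    have hin : Continuous fun u => ∫ s, Q u s * ‖x s - y s‖ ∂μ :=
      fr_param μ (h := fun u s => Q u s * ‖x s - y s‖) (hQ.mul (by fun_prop))
    rw [Function.iterate_succ_apply, Function.iterate_succ_apply F (n+1) y]
    calc _ ≤ ∫ u, iterKernel μ Q n t u * ‖F x u - F y u‖ ∂μ := ih _ _ t
      _ ≤ ∫ u, iterKernel μ Q n t u * ∫ s, Q u s * ‖x s - y s‖ ∂μ ∂μ := by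
        refine integral_mono (fr_integrable μ (by fun_prop)) (fr_integrable μ (hKt.mul hin)) ?_
        intro u
        exact mul_le_mul_of_nonneg_left (hF x y u) (fr_kernel_nonneg μ Q hQ0 n t u)
      _ = ∫ u, ∫ s, iterKernel μ Q n t u * (Q u s * ‖x s - y s‖) ∂μ ∂μ := by
        simp only [integral_const_mul]
      _ = ∫ s, ∫ u, iterKernel μ Q n t u * (Q u s * ‖x s - y s‖) ∂μ ∂μ := by
        refine integral_integral_swap_of_hasCompactSupport
          (f := fun u s => iterKernel μ Q n t u * (Q u s * ‖x s - y s‖)) ?_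
          (HasCompactSupport.of_compactSpace _)
        exact (hKt.comp continuous_fst).mul (hQ.mul (hd.comp continuous_snd))
      _ = _ := by
        simp only [← mul_assoc, integral_mul_const, iterKernel]

/-- existence and uniqueness of a continuous solution of the Fredholm
integral equation `x(t) = f(t) + ∫_T g(t, s, x(s)) dμ(s)`, provided the series
`∑_{n=1}^∞ ∫_T Q_n(t, s) dμ(s)` of integrals of the iterated kernels converges
uniformly in `t` (i.e. in `C(T, ℝ)` with the sup-norm). -/
theorem fredholm_integral_equation {T : Type*} [MetricSpace T] [CompactSpace T]
    [MeasurableSpace T] [BorelSpace T]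
    (μ : Measure T) [IsFiniteMeasure μ]
    {X : Type*} [NormedAddCommGroup X] [NormedSpace ℝ X] [CompleteSpace X]
    (f : C(T, X))
    (Q : T → T → ℝ)
    (hQcont : Continuous fun p : T × T => Q p.1 p.2)
    (hQnonneg : ∀ t s : T, 0 ≤ Q t s)
    (g : T → T → X → X)
    (hgcont : Continuous fun p : T × T × X => g p.1 p.2.1 p.2.2)
    (hglip : ∀ (t s : T) (u v : X), ‖g t s u - g t s v‖ ≤ Q t s * ‖u - v‖)
    (hconv : ∃ S : T → ℝ, TendstoUniformly
      (fun (N : ℕ) (t : T) => ∑ n ∈ Finset.range N, ∫ s, iterKernel μ Q n t s ∂μ)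
      S Filter.atTop) :
    ∃! x : C(T, X), ∀ t : T, x t = f t + ∫ s, g t s (x s) ∂μ := by
  have hgx (x : C(T, X)) : Continuous fun p : T × T => g p.1 p.2 (x p.2) :=
    hgcont.comp (f := fun p : T × T => (p.1, p.2, x p.2)) (by fun_prop)
  have hgt (x : C(T, X)) (t : T) : Continuous fun s => g t s (x s) :=
    (hgx x).comp (f := fun s => (t, s)) (by fun_prop)
  let F : C(T, X) → C(T, X) := fun x =>
    ⟨fun t => f t + ∫ s, g t s (x s) ∂μ,
      f.continuous.add (fr_param μ (h := fun t s => g t s (x s)) (hgx x))⟩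
  have hFapp (x : C(T, X)) (t : T) : F x t = f t + ∫ s, g t s (x s) ∂μ := rfl
  have hF : ∀ x y t, ‖F x t - F y t‖ ≤ ∫ s, Q t s * ‖x s - y s‖ ∂μ := by
    intro x y t
    have hQt : Continuous fun s => Q t s := hQcont.comp (f := fun s => (t, s)) (by fun_prop)
    rw [hFapp, hFapp, add_sub_add_left_eq_sub,
      ← integral_sub (fr_integrable μ (hgt x t)) (fr_integrable μ (hgt y t))]
    exact norm_integral_le_of_norm_le (fr_integrable μ (by fun_prop))
      (Filter.Eventually.of_forall fun s => hglip t s _ _)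
  obtain ⟨S, hS⟩ := hconv
  obtain ⟨N, hN⟩ := Filter.eventually_atTop.1
    (Metric.tendstoUniformly_iff.1 hS (1/4) (by norm_num))
  have hsmall (t : T) : ∫ s, iterKernel μ Q N t s ∂μ ≤ 1/2 := by
    have h1 := hN N le_rfl t
    have h2 := hN (N+1) (Nat.le_succ N) t
    rw [Real.dist_eq, abs_lt] at h1 h2
    rw [Finset.sum_range_succ] at h2
    linarith [h1.1, h1.2, h2.1, h2.2]
  have hcontr : ContractingWith (1/2 : NNReal) F^[N+1] := by
    refine ⟨by rw [← NNReal.coe_lt_coe]; norm_num, LipschitzWith.of_dist_le_mul fun x y => ?_⟩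
    refine (ContinuousMap.dist_le (by positivity)).2 fun t => ?_
    have hKt : Continuous fun u => iterKernel μ Q N t u :=
      (fr_kernel_cont μ Q hQcont N).comp (f := fun u => (t, u)) (by fun_prop)
    rw [dist_eq_norm]
    calc _ ≤ ∫ s, iterKernel μ Q N t s * ‖x s - y s‖ ∂μ :=
          fr_iter μ Q hQcont hQnonneg F hF N x y t
      _ ≤ ∫ s, iterKernel μ Q N t s * dist x y ∂μ := by
        refine integral_mono (fr_integrable μ (by fun_prop)) (fr_integrable μ (by fun_prop)) ?_
        intro s
        refine mul_le_mul_of_nonneg_left ?_ (fr_kernel_nonneg μ Q hQnonneg N t s)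
        rw [← dist_eq_norm]
        exact ContinuousMap.dist_apply_le_dist s
      _ = (∫ s, iterKernel μ Q N t s ∂μ) * dist x y := integral_mul_const _ _
      _ ≤ (1/2) * dist x y := mul_le_mul_of_nonneg_right (hsmall t) dist_nonneg
      _ = _ := by norm_num
  have : Nonempty C(T, X) := ⟨f⟩
  have hfix := hcontr.isFixedPt_fixedPoint_iterate
  refine ⟨ContractingWith.fixedPoint F^[N + 1] hcontr, fun t => ?_, fun y hy => ?_⟩
  · exact (DFunLike.congr_fun hfix t).symm
  · have hyF : Function.IsFixedPt F y := by
      ext t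
      exact (hy t).symm
    exact hcontr.fixedPoint_unique (hyF.iterate (N+1))
end
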